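/- Let (R, 𝔪) be a complete Noetherian local Cohen–Macaulay ring that is a k-algebra with residue field k (k a field), and let M, N be finitely generated R-modules. If M ⇒_deg N and N is a maximal Cohen–Macaulay R-module, then M is a maximal Cohen–Macaulay R-module. -/

import Mathlib

open Polynomial TensorProduct

noncomputable section

/-- The prime ideal `(t)` of the polynomial ring `k[t]`. -/
def tIdeal (k : Type) [Field k] : Ideal (Polynomial k) := Ideal.span {Polynomial.X}

instance tIdeal_isPrime (k : Type) [Field k] : (tIdeal k).IsPrime := by
  have h : tIdeal k = RingHom.ker (Polynomial.evalRingHom (0 : k)) := by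
    rw [Polynomial.ker_evalRingHom]
    simp [tIdeal]
  rw [h]
  exact RingHom.ker_isPrime _

/-- `V = k[t]_{(t)}`, the localization of the polynomial ring `k[t]` at the prime ideal `(t)`. -/
def DegV (k : Type) [Field k] : Type := Localization.AtPrime (tIdeal k)

instance (k : Type) [Field k] : CommRing (DegV k) :=
  inferInstanceAs (CommRing (Localization.AtPrime (tIdeal k)))

instance (k : Type) [Field k] : Algebra (Polynomial k) (DegV k) :=
  inferInstanceAs (Algebra (Polynomial k) (Localization.AtPrime (tIdeal k)))

instance (k : Type) [Field k] : Algebra k (DegV k) :=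
  inferInstanceAs (Algebra k (Localization.AtPrime (tIdeal k)))

instance (k : Type) [Field k] : IsScalarTower k (Polynomial k) (DegV k) :=
  inferInstanceAs (IsScalarTower k (Polynomial k) (Localization.AtPrime (tIdeal k)))

/-- The element `t` of `V = k[t]_{(t)}`. -/
def degT (k : Type) [Field k] : DegV k := algebraMap (Polynomial k) (DegV k) Polynomial.X

/-- `K = V[t⁻¹]`, which is the fraction field `k(t)` of `V = k[t]_{(t)}`. -/
def DegK (k : Type) [Field k] : Type := Localization (Submonoid.powers (degT k))

instance (k : Type) [Field k] : CommRing (DegK k) :=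
  inferInstanceAs (CommRing (Localization (Submonoid.powers (degT k))))

instance (k : Type) [Field k] : Algebra (DegV k) (DegK k) :=
  inferInstanceAs (Algebra (DegV k) (Localization (Submonoid.powers (degT k))))

instance (k : Type) [Field k] : Algebra k (DegK k) :=
  inferInstanceAs (Algebra k (Localization (Submonoid.powers (degT k))))

/-- The localized module `Q[t⁻¹]` is a module over `K = V[t⁻¹]`. -/
instance (k : Type) [Field k] (Q : Type) [AddCommGroup Q] [Module (DegV k) Q] :
    Module (DegK k) (LocalizedModule (Submonoid.powers (degT k)) Q) :=
  inferInstanceAs (Module (Localization (Submonoid.powers (degT k)))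
    (LocalizedModule (Submonoid.powers (degT k)) Q))

section

variable (k : Type) [Field k] (R : Type) [Ring R] [Algebra k R]

/-- `1 ⊗ t` is central in `R ⊗[k] V`. -/
theorem degT_central (x : R ⊗[k] DegV k) :
    x * ((1 : R) ⊗ₜ[k] degT k) = ((1 : R) ⊗ₜ[k] degT k) * x := by
  induction x with
  | zero => simp
  | tmul a v => simp [Algebra.TensorProduct.tmul_mul_tmul, mul_comm]
  | add x y hx hy => simp [add_mul, mul_add, hx, hy]

/-- Multiplication by `1 ⊗ t` on an `R ⊗[k] V`-module, as an `R ⊗[k] V`-linear map. -/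
def tSmul (Q : Type) [AddCommGroup Q] [Module (R ⊗[k] DegV k) Q] :
    Q →ₗ[R ⊗[k] DegV k] Q where
  toFun q := ((1 : R) ⊗ₜ[k] degT k) • q
  map_add' := smul_add _
  map_smul' x q := by
    simp only [RingHom.id_apply, ← mul_smul, degT_central]

/-- The `R`-module structure on an `R ⊗[k] V`-module obtained by restriction of scalars
along `R → R ⊗[k] V`. -/
def rRestrict (Q : Type) [AddCommGroup Q] [Module (R ⊗[k] DegV k) Q] : Module R Q :=
  Module.compHom Q (Algebra.TensorProduct.includeLeftRingHom : R →+* R ⊗[k] DegV k)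

/-- The `V`-module structure on an `R ⊗[k] V`-module obtained by restriction of scalars
along `V → R ⊗[k] V`. -/
def vRestrict (Q : Type) [AddCommGroup Q] [Module (R ⊗[k] DegV k) Q] : Module (DegV k) Q :=
  Module.compHom Q
    ((Algebra.TensorProduct.includeRight : DegV k →ₐ[k] R ⊗[k] DegV k) : DegV k →+* R ⊗[k] DegV k)

/-- The action of `r : R` on an `R ⊗[k] V`-module `Q`, as a `V`-linear endomorphism of `Q`. -/
def rAct (Q : Type) [AddCommGroup Q] [Module (R ⊗[k] DegV k) Q] (r : R) :
    letI := vRestrict k R Q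
    Q →ₗ[DegV k] Q :=
  letI := vRestrict k R Q
  { toFun := fun q => (r ⊗ₜ[k] (1 : DegV k)) • q
    map_add' := smul_add _
    map_smul' := fun v q => by
      show (r ⊗ₜ[k] (1 : DegV k)) • (((1 : R) ⊗ₜ[k] v) • q)
        = ((1 : R) ⊗ₜ[k] v) • ((r ⊗ₜ[k] (1 : DegV k)) • q)
      rw [← mul_smul, ← mul_smul, Algebra.TensorProduct.tmul_mul_tmul,
        Algebra.TensorProduct.tmul_mul_tmul, one_mul, mul_one, one_mul, mul_one] }

/-- The action of `r : R` on a module `M`, as a `k`-linear endomorphism of `M`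
(where `M` is viewed as a `k`-module by restriction of scalars along `k → R`). -/
def rActK (M : Type) [AddCommGroup M] [Module R M] (r : R) :
    letI := Module.compHom M (algebraMap k R)
    M →ₗ[k] M :=
  letI := Module.compHom M (algebraMap k R)
  { toFun := fun m => r • m
    map_add' := smul_add r
    map_smul' := fun c m => by
      show r • ((algebraMap k R c) • m) = (algebraMap k R c) • (r • m)
      rw [← mul_smul, ← mul_smul, Algebra.commutes] }

/-- Degeneration of modules (Yoshino): `M ⇒_deg N` iff there is a finitely generated
`R ⊗[k] V`-module `Q`, flat over `V`, with `Q/tQ ≅ N` as `R`-modules and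
`Q_t = Q[t⁻¹] ≅ M ⊗[k] K` compatibly with the `R`- and `K`-actions
(i.e. as `R ⊗[k] K`-modules). -/
def Degenerates (M N : Type) [AddCommGroup M] [Module R M] [AddCommGroup N] [Module R N] :
    Prop :=
  ∃ (Q : Type) (_ : AddCommGroup Q) (_ : Module (R ⊗[k] DegV k) Q),
    Module.Finite (R ⊗[k] DegV k) Q ∧
    (letI := vRestrict k R Q; Module.Flat (DegV k) Q) ∧
    -- `Q/tQ ≅ N` as `R`-modules
    (letI := rRestrict k R (Q ⧸ LinearMap.range (tSmul k R Q))
     Nonempty ((Q ⧸ LinearMap.range (tSmul k R Q)) ≃ₗ[R] N)) ∧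
    -- `Q_t ≅ M ⊗_k K` as `R ⊗_k K`-modules, i.e. compatibly with both actions
    (letI := vRestrict k R Q
     letI : Module k M := Module.compHom M (algebraMap k R)
     ∃ f : LocalizedModule (Submonoid.powers (degT k)) Q ≃+ (M ⊗[k] DegK k),
       (∀ (c : DegK k) (x : LocalizedModule (Submonoid.powers (degT k)) Q),
          f (c • x) = LinearMap.lTensor M (LinearMap.mulLeft k c) (f x)) ∧
       (∀ (r : R) (x : LocalizedModule (Submonoid.powers (degT k)) Q),
          f (LocalizedModule.map (Submonoid.powers (degT k)) (rAct k R Q r) x)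
            = LinearMap.rTensor (DegK k) (rActK k R M r) (f x)))

end

/-- The depth of a module `M` over a local ring `R`: the supremum of the lengths of
`M`-regular sequences consisting of elements of the maximal ideal. -/
noncomputable def moduleDepth (R : Type) [CommRing R] [IsLocalRing R]
    (M : Type) [AddCommGroup M] [Module R M] : ℕ∞ :=
  sSup {n : ℕ∞ | ∃ rs : List R, (rs.length : ℕ∞) = n ∧
    (∀ r ∈ rs, r ∈ IsLocalRing.maximalIdeal R) ∧ RingTheory.Sequence.IsRegular M rs}

/-- A module `M` over a local ring `R` is maximal Cohen–Macaulay if `depth M = dim R`. -/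
def IsMCM (R : Type) [CommRing R] [IsLocalRing R]
    (M : Type) [AddCommGroup M] [Module R M] : Prop :=
  (moduleDepth R M : WithBot ℕ∞) = ringKrullDim R

/-- A local ring `R` is Cohen–Macaulay if `depth R = dim R`. -/
def IsCMLocalRing (R : Type) [CommRing R] [IsLocalRing R] : Prop :=
  (moduleDepth R R : WithBot ℕ∞) = ringKrullDim R

open RingTheory.Sequence

lemma isWeaklyRegular_descent {R B : Type} [CommRing R] [CommRing B] [Algebra R B]
    [Module.FaithfullyFlat R B] (rs : List R) :
    ∀ (M : Type) [AddCommGroup M] [Module R M], IsWeaklyRegular (B ⊗[R] M) rs →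
      IsWeaklyRegular M rs := by
  induction rs with
  | nil => intro M _ _ _; simp
  | cons x rs ih =>
    intro M _ _ h
    rw [isWeaklyRegular_cons_iff] at h ⊢
    refine ⟨?_, ih _ ?_⟩
    · have h1 := h.1
      have : Function.Injective ((LinearMap.lsmul R M x).lTensor B) := by
        have e : (LinearMap.lsmul R M x).lTensor B = LinearMap.lsmul R (B ⊗[R] M) x := by
          ext; simp
        rw [e]; exact h1
      exact (Module.FaithfullyFlat.lTensor_injective_iff_injective R B _).mp this
    · exact ((QuotSMulTop.tensorQuotSMulTopEquivQuotSMulTop x B M).isWeaklyRegular_congr _).mpr h.2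

def TorsIso {A Q L : Type} [CommRing A] [AddCommGroup Q] [Module A Q] [AddCommGroup L]
    [Module A L] (S : Submonoid A) (g : Q →ₗ[A] L) : Prop :=
  (∀ q, g q = 0 → ∃ s ∈ S, s • q = 0) ∧ (∀ l, ∃ s ∈ S, ∃ q, s • l = g q)

lemma TorsIso.mono {A Q L : Type} [CommRing A] [AddCommGroup Q] [Module A Q] [AddCommGroup L]
    [Module A L] {S T : Submonoid A} {g : Q →ₗ[A] L} (h : TorsIso S g) (hST : S ≤ T) :
    TorsIso T g := 
  ⟨fun q hq => let ⟨s, hs, h⟩ := h.1 q hq; ⟨s, hST hs, h⟩,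
   fun q => let ⟨s, hs, h⟩ := h.2 q; ⟨s, hST hs, h⟩⟩

lemma TorsIso.bijective {A Q L : Type} [CommRing A] [AddCommGroup Q] [Module A Q] [AddCommGroup L]
    [Module A L] {S : Submonoid A} {g : Q →ₗ[A] L} (h : TorsIso S g) :
    Function.Bijective (LocalizedModule.map S g) := by
  constructor
  · rw [injective_iff_map_eq_zero]
    intro a ha
    induction a using LocalizedModule.induction_on with
    | h q s =>
      rw [LocalizedModule.map_mk, ← LocalizedModule.zero_mk 1, LocalizedModule.mk_eq] at ha
      obtain ⟨u, hu⟩ := ha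
      simp only [one_smul, smul_zero, Submonoid.smul_def] at hu
      rw [← map_smul] at hu
      obtain ⟨v, hv, hq⟩ := h.1 _ hu
      rw [← LocalizedModule.zero_mk 1, LocalizedModule.mk_eq]
      exact ⟨⟨v, hv⟩ * u, by simpa [Submonoid.smul_def, mul_smul] using hq⟩
  · intro a
    induction a using LocalizedModule.induction_on with
    | h l s =>
      obtain ⟨u, hu, q, hq⟩ := h.2 l
      refine ⟨LocalizedModule.mk q (⟨u, hu⟩ * s), ?_⟩
      rw [LocalizedModule.map_mk, ← hq]
      exact LocalizedModule.mk_cancel_common_left ⟨u, hu⟩ s l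

lemma torsIso_of_isLocalizedModule {A Q L : Type} [CommRing A] [AddCommGroup Q] [Module A Q]
    [AddCommGroup L] [Module A L] (S : Submonoid A) (g : Q →ₗ[A] L) [IsLocalizedModule S g] :
    TorsIso S g := by
  constructor
  · intro q hq
    obtain ⟨s, hs⟩ := (IsLocalizedModule.eq_zero_iff S g).mp hq
    exact ⟨s, s.2, hs⟩
  · intro l
    obtain ⟨⟨q, s⟩, hs⟩ := IsLocalizedModule.surj S g l
    exact ⟨s, s.2, q, hs⟩

lemma main_abstract {R A B : Type} [CommRing R] [CommRing A] [CommRing B] [Algebra R A] 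
    [Algebra A B] [Algebra R B] [IsScalarTower R A B]
    [IsNoetherianRing A] (P : Ideal A) [P.IsPrime] (τ : A) (hτ : τ ∈ P)
    [IsLocalization (P.primeCompl ⊔ Submonoid.powers τ) B] [Module.FaithfullyFlat R B]
    (M Q L : Type) [AddCommGroup M] [Module R M] [AddCommGroup Q] [Module A Q] [Module.Finite A Q]
    [AddCommGroup L] [Module A L] (g : Q →ₗ[A] L) (h : (A ⊗[R] M) →ₗ[A] L)
    (hg : TorsIso (Submonoid.powers τ) g) (hh : TorsIso (Submonoid.powers τ) h)
    (rs : List R) (hrs : ∀ r ∈ rs, algebraMap R A r ∈ P)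
    (hreg : IsWeaklyRegular Q (τ :: rs.map (algebraMap R A))) : IsWeaklyRegular M rs := by
  set S := P.primeCompl ⊔ Submonoid.powers τ with hS
  have h1 : IsWeaklyRegular (LocalizedModule P.primeCompl Q) 
      ((τ :: rs.map (algebraMap R A)).map (algebraMap A (Localization.AtPrime P))) :=
    hreg.of_isLocalizedModule (Localization.AtPrime P) P.primeCompl 
      (LocalizedModule.mkLinearMap P.primeCompl Q)
  have hfin : Module.Finite (Localization.AtPrime P) (LocalizedModule P.primeCompl Q) := 
    inferInstance
  have hN : IsNoetherianRing (Localization.AtPrime P) := IsLocalization.isNoetherianRing P.primeCompl _ inferInstance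
  have h2 : IsWeaklyRegular (LocalizedModule P.primeCompl Q) 
      ((rs.map (algebraMap R A) ++ [τ]).map (algebraMap A (Localization.AtPrime P))) := by
    refine IsLocalRing.isWeaklyRegular_of_perm_of_subset_maximalIdeal h1 ?_ ?_
    · exact (List.perm_append_singleton _ _).symm.map _
    · intro r hr
      obtain ⟨a, ha, rfl⟩ := List.mem_map.mp hr
      rw [IsLocalization.AtPrime.to_map_mem_maximal_iff _ P]
      rcases List.mem_cons.mp ha with rfl | ha
      · exact hτ
      · obtain ⟨r, hr2, rfl⟩ := List.mem_map.mp ha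
        exact hrs r hr2
  rw [isWeaklyRegular_map_algebraMap_iff, isWeaklyRegular_append_iff] at h2
  have h3 := h2.1
  have key : ∀ (X : Type) [AddCommGroup X] [Module A X] (Y : Type) [AddCommGroup Y] [Module A Y]
    (f : X →ₗ[A] Y), TorsIso S f → (IsWeaklyRegular (LocalizedModule S X) (rs.map (algebraMap R A)) ↔ IsWeaklyRegular (LocalizedModule S Y) (rs.map (algebraMap R A))) := by
    intro X _ _ Y _ _ f hf
    exact ((LinearEquiv.ofBijective _ hf.bijective).restrictScalars A).isWeaklyRegular_congr _
  have h4 : IsWeaklyRegular (LocalizedModule S (LocalizedModule P.primeCompl Q)) (rs.map (algebraMap R A)) := by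
    have := h3.of_isLocalizedModule (Localization S) S (LocalizedModule.mkLinearMap S _)
    rwa [isWeaklyRegular_map_algebraMap_iff] at this
  rw [← key _ _ (LocalizedModule.mkLinearMap P.primeCompl Q) 
     ((torsIso_of_isLocalizedModule _ _).mono le_sup_left), key _ _ g (hg.mono le_sup_right),
     ← key _ _ h (hh.mono le_sup_right)] at h4
  have e : LocalizedModule S (A ⊗[R] M) ≃ₗ[A] B ⊗[A] (A ⊗[R] M) :=
    IsLocalizedModule.linearEquiv S (LocalizedModule.mkLinearMap S _) (TensorProduct.mk A B (A ⊗[R] M) 1)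
  rw [e.isWeaklyRegular_congr] at h4
  let e2 : B ⊗[A] (A ⊗[R] M) ≃ₗ[A] B ⊗[R] M := 
    (AlgebraTensorModule.cancelBaseChange R A B B M).restrictScalars A
  rw [e2.isWeaklyRegular_congr, isWeaklyRegular_map_algebraMap_iff] at h4
  exact isWeaklyRegular_descent rs M h4

section facts
variable (k : Type) [Field k]

instance degV_isDomain : IsDomain (DegV k) :=
  IsLocalization.isDomain_localization (Ideal.primeCompl_le_nonZeroDivisors (tIdeal k))

instance degV_isLocalRing : IsLocalRing (DegV k) :=
  inferInstanceAs (IsLocalRing (Localization.AtPrime (tIdeal k)))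

instance degV_ess : Algebra.EssFiniteType k (DegV k) :=
  inferInstanceAs (Algebra.EssFiniteType k (Localization (tIdeal k).primeCompl))

instance degVK_tower : IsScalarTower k (DegV k) (DegK k) :=
  inferInstanceAs (IsScalarTower k (DegV k) (Localization (Submonoid.powers (degT k))))

instance degVK_loc : IsLocalization (Submonoid.powers (degT k)) (DegK k) :=
  inferInstanceAs (IsLocalization (Submonoid.powers (degT k)) (Localization (Submonoid.powers (degT k))))

lemma degT_mem : degT k ∈ IsLocalRing.maximalIdeal (DegV k) := by
  refine (IsLocalization.AtPrime.to_map_mem_maximal_iff (Localization.AtPrime (tIdeal k)) (tIdeal k) X).mpr ?_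
  exact Ideal.subset_span rfl

lemma degT_ne_zero : degT k ≠ 0 := by
  intro h
  have : Function.Injective (algebraMap k[X] (Localization.AtPrime (tIdeal k))) :=
    IsLocalization.injective _ (Ideal.primeCompl_le_nonZeroDivisors (tIdeal k))
  exact X_ne_zero (this (h.trans (map_zero _).symm))

lemma degVK_injective : Function.Injective (algebraMap (DegV k) (DegK k)) :=
  IsLocalization.injective (DegK k) (M := Submonoid.powers (degT k))
    (powers_le_nonZeroDivisors_of_noZeroDivisors (degT_ne_zero k))

instance degK_nontrivial : Nontrivial (DegK k) := (degVK_injective k).nontrivial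

variable (R : Type) [CommRing R] [Algebra k R]

instance degA_noeth [IsNoetherianRing R] : IsNoetherianRing (R ⊗[k] DegV k) :=
  Algebra.EssFiniteType.isNoetherianRing R (R ⊗[k] DegV k)

/-- specialization `R ⊗ V → V` -/
def degPhi (e : R →ₐ[k] k) : R ⊗[k] DegV k →ₐ[k] DegV k :=
  Algebra.TensorProduct.lift ((Algebra.ofId k (DegV k)).comp e) (AlgHom.id k _) (fun _ _ => mul_comm _ _)

@[simp] lemma degPhi_tmul (e : R →ₐ[k] k) (r : R) (v : DegV k) :
    degPhi k R e (r ⊗ₜ v) = algebraMap k _ (e r) * v := by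
  exact Algebra.TensorProduct.lift_tmul _ _ _ _ _

/-- the prime -/
def degP (e : R →ₐ[k] k) : Ideal (R ⊗[k] DegV k) :=
  (IsLocalRing.maximalIdeal (DegV k)).comap (degPhi k R e)

instance (e : R →ₐ[k] k) : (degP k R e).IsPrime := Ideal.comap_isPrime _ _

lemma exists_aug [IsLocalRing R]
    (hres : Function.Bijective ⇑((IsLocalRing.residue R).comp (algebraMap k R))) :
    ∃ e : R →ₐ[k] k, ∀ r ∈ IsLocalRing.maximalIdeal R, e r = 0 := by
  let E : k ≃+* IsLocalRing.ResidueField R := RingEquiv.ofBijective _ hres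
  refine ⟨⟨(E.symm : IsLocalRing.ResidueField R →+* k).comp (IsLocalRing.residue R), ?_⟩, ?_⟩
  · intro c
    exact E.symm_apply_apply c
  · intro r hr
    have : IsLocalRing.residue R r = 0 := (IsLocalRing.residue_eq_zero_iff r).mpr hr
    show E.symm (IsLocalRing.residue R r) = 0
    rw [this, map_zero]

/-- the submonoid -/
abbrev degS (e : R →ₐ[k] k) : Submonoid (R ⊗[k] DegV k) :=
  (degP k R e).primeCompl ⊔ Submonoid.powers ((1 : R) ⊗ₜ[k] degT k)

lemma degB_ff [IsLocalRing R] (e : R →ₐ[k] k) (he : ∀ r ∈ IsLocalRing.maximalIdeal R, e r = 0) :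
    Module.FaithfullyFlat R (Localization (degS k R e)) := by
  have hfl : Module.Flat (R ⊗[k] DegV k) (Localization (degS k R e)) :=
    IsLocalization.flat _ (degS k R e)
  have hfl2 : Module.Flat R (Localization (degS k R e)) :=
    Module.Flat.trans R (R ⊗[k] DegV k) _
  let φ : R ⊗[k] DegV k →+* DegK k := (algebraMap (DegV k) (DegK k)).comp (degPhi k R e).toRingHom
  have hφ : ∀ s : degS k R e, IsUnit (φ s) := by
    have : degS k R e ≤ (IsUnit.submonoid (DegK k)).comap φ := by
      refine sup_le ?_ ?_
      · intro s hs
        have : IsUnit (degPhi k R e s) := by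
          by_contra h
          exact hs h
        exact this.map (algebraMap (DegV k) (DegK k))
      · rw [Submonoid.powers_le]
        show IsUnit (algebraMap (DegV k) (DegK k) (degPhi k R e _))
        rw [degPhi_tmul, map_one, map_one, one_mul]
        exact IsLocalization.map_units (M := Submonoid.powers (degT k)) (DegK k) ⟨_, Submonoid.mem_powers _⟩
    exact fun s => this s.2
  let ψ : Localization (degS k R e) →+* DegK k := IsLocalization.lift hφ
  have hψ : ∀ a, ψ (algebraMap (R ⊗[k] DegV k) _ a) = φ a := fun a => IsLocalization.lift_eq hφ a
  refine ⟨fun {m} hm htop => ?_⟩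
  have hm' := IsLocalRing.eq_maximalIdeal hm
  subst hm'
  have h1 : (1 : Localization (degS k R e)) ∈ (IsLocalRing.maximalIdeal R) • (⊤ : Submodule R (Localization (degS k R e))) := by
    rw [htop]; trivial
  have : ∀ x ∈ (IsLocalRing.maximalIdeal R) • (⊤ : Submodule R (Localization (degS k R e))), ψ x = 0 := by
    intro x hx
    induction hx using Submodule.smul_induction_on' with
    | smul r hr n hn =>
      rw [Algebra.smul_def, map_mul, IsScalarTower.algebraMap_apply R (R ⊗[k] DegV k), hψ]
      have : φ (algebraMap R _ r) = 0 := by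
        show algebraMap (DegV k) (DegK k) (degPhi k R e (r ⊗ₜ 1)) = 0
        simp [he r hr]
      rw [this, zero_mul]
    | add x _ y _ hx hy => rw [map_add, hx, hy, add_zero]
  have := this 1 h1
  rw [map_one] at this
  exact one_ne_zero this

end facts

section latt
variable (k : Type) [Field k] (R : Type) [CommRing R] [Algebra k R]
variable (M : Type) [AddCommGroup M] [Module R M] [Module k M] [IsScalarTower k R M]

/-- the action of `R` on `M ⊗ K` -/
def degRhoR : R →ₐ[k] Module.End k (M ⊗[k] DegK k) :=
  (Module.End.rTensorAlgHom k M (DegK k)).comp (Algebra.lsmul k k M)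

/-- the action of `V` on `M ⊗ K` -/
def degRhoV : DegV k →ₐ[k] Module.End k (M ⊗[k] DegK k) :=
  ((Module.End.lTensorAlgHom k (DegK k) M).comp (Algebra.lmul k (DegK k))).comp
      (IsScalarTower.toAlgHom k (DegV k) (DegK k))

lemma degRhoV_apply (v : DegV k) : degRhoV k M v =
    LinearMap.lTensor M (LinearMap.mulLeft k (algebraMap (DegV k) (DegK k) v)) := rfl

lemma degRhoR_apply (r : R) : degRhoR k R M r =
    LinearMap.rTensor (DegK k) (Algebra.lsmul k k M r) := rfl

lemma degRho_commute (r : R) (v : DegV k) : Commute (degRhoR k R M r) (degRhoV k M v) := by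
  rw [degRhoR_apply, degRhoV_apply]
  show _ ∘ₗ _ = _ ∘ₗ _
  rw [LinearMap.rTensor_comp_lTensor, LinearMap.lTensor_comp_rTensor]

/-- the action of `R ⊗ V` on `M ⊗ K` -/
def degRho : R ⊗[k] DegV k →ₐ[k] Module.End k (M ⊗[k] DegK k) :=
  Algebra.TensorProduct.lift (degRhoR k R M) (degRhoV k M) (degRho_commute k R M)

lemma degRho_tmul (r : R) (v : DegV k) (x : M ⊗[k] DegK k) : 
    degRho k R M (r ⊗ₜ v) x = LinearMap.rTensor (DegK k) (Algebra.lsmul k k M r)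
      (LinearMap.lTensor M (LinearMap.mulLeft k (algebraMap (DegV k) (DegK k) v)) x) := by
  have := Algebra.TensorProduct.lift_tmul (degRhoR k R M) (degRhoV k M)
    (degRho_commute k R M) r v
  exact LinearMap.congr_fun this x

@[reducible] def degLModule : Module (R ⊗[k] DegV k) (M ⊗[k] DegK k) :=
  Module.compHom _ (degRho k R M).toRingHom

attribute [local instance] degLModule

lemma degL_smul (r : R) (v : DegV k) (x : M ⊗[k] DegK k) : 
    (r ⊗ₜ[k] v : R ⊗[k] DegV k) • x = LinearMap.rTensor (DegK k) (Algebra.lsmul k k M r)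
      (LinearMap.lTensor M (LinearMap.mulLeft k (algebraMap (DegV k) (DegK k) v)) x) :=
  degRho_tmul k R M r v x

lemma degL_smul_tmul (r : R) (v : DegV k) (m : M) (c : DegK k) : 
    (r ⊗ₜ[k] v : R ⊗[k] DegV k) • (m ⊗ₜ[k] c : M ⊗[k] DegK k) =
      (r • m) ⊗ₜ[k] (algebraMap (DegV k) (DegK k) v * c) := by
  rw [degL_smul]; rfl

lemma degL_tower : IsScalarTower R (R ⊗[k] DegV k) (M ⊗[k] DegK k) := by
  refine IsScalarTower.of_algebraMap_smul fun r x => ?_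
  show (r ⊗ₜ[k] (1 : DegV k) : R ⊗[k] DegV k) • x = r • x
  induction x with
  | zero => simp
  | tmul m c => rw [degL_smul_tmul, map_one, one_mul, smul_tmul']
  | add x y hx hy => rw [smul_add, smul_add, hx, hy]

attribute [local instance] degL_tower

def degH : ((R ⊗[k] DegV k) ⊗[R] M) →ₗ[R ⊗[k] DegV k] (M ⊗[k] DegK k) :=
  LinearMap.liftBaseChange _ ((AlgebraTensorModule.mk k R M (DegK k)).flip 1)

lemma degH_tmul (r : R) (v : DegV k) (m : M) :
    degH k R M ((r ⊗ₜ v) ⊗ₜ m) = (r • m) ⊗ₜ algebraMap (DegV k) (DegK k) v := by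
  rw [degH, LinearMap.liftBaseChange_tmul]
  show (r ⊗ₜ[k] v : R ⊗[k] DegV k) • (m ⊗ₜ[k] (1 : DegK k) : M ⊗[k] DegK k) = _
  rw [degL_smul_tmul, mul_one]

lemma degH_torsIso : TorsIso (Submonoid.powers ((1 : R) ⊗ₜ[k] degT k)) (degH k R M) := by
  constructor
  · let e : (R ⊗[k] DegV k) ⊗[R] M ≃ₗ[R] M ⊗[k] DegV k :=
      TensorProduct.comm R _ M ≪≫ₗ AlgebraTensorModule.cancelBaseChange k R R M (DegV k)
    let i : DegV k →ₗ[k] DegK k := (IsScalarTower.toAlgHom k (DegV k) (DegK k)).toLinearMap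
    have he : ∀ x, degH k R M x = LinearMap.lTensor M i (e x) := by
      intro x
      induction x with
      | zero => simp
      | add x y hx hy => rw [map_add, hx, hy, map_add, map_add]
      | tmul a m =>
        induction a with
        | zero => simp
        | add x y hx hy => rw [add_tmul, map_add, hx, hy, map_add, map_add]
        | tmul r v =>
          rw [degH_tmul]
          simp [e, i]
    have hi : Function.Injective (LinearMap.lTensor M i) :=
      Module.Flat.lTensor_preserves_injective_linearMap i (degVK_injective k)
    intro q hq
    refine ⟨1, one_mem _, ?_⟩
    rw [one_smul]
    rw [he] at hq
    exact e.injective ((hi (hq.trans (map_zero _).symm)).trans (map_zero _).symm)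
  · intro l
    induction l with
    | zero => exact ⟨1, one_mem _, 0, by simp⟩
    | tmul m c =>
      obtain ⟨⟨v, ⟨_, n, rfl⟩⟩, hv⟩ := IsLocalization.surj (Submonoid.powers (degT k)) c
      refine ⟨_, ⟨n, rfl⟩, (1 ⊗ₜ v) ⊗ₜ m, ?_⟩
      simp only [Algebra.TensorProduct.tmul_pow, one_pow] at hv ⊢
      rw [degL_smul_tmul, degH_tmul, ← hv, mul_comm]
    | add x y hx hy =>
      obtain ⟨s, hs, q, hq⟩ := hx
      obtain ⟨s', hs', q', hq'⟩ := hy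
      refine ⟨s * s', mul_mem hs hs', s' • q + s • q', ?_⟩
      rw [map_add, map_smul, map_smul, ← hq, ← hq', smul_add, mul_smul, mul_smul, smul_comm s s' x]

lemma exists_degG (Q : Type) [AddCommGroup Q] [Module (R ⊗[k] DegV k) Q]
    (hf : letI := vRestrict k R Q
     ∃ f : LocalizedModule (Submonoid.powers (degT k)) Q ≃+ (M ⊗[k] DegK k),
       (∀ (c : DegK k) (x : LocalizedModule (Submonoid.powers (degT k)) Q),
          f (c • x) = LinearMap.lTensor M (LinearMap.mulLeft k c) (f x)) ∧
       (∀ (r : R) (x : LocalizedModule (Submonoid.powers (degT k)) Q),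
          f (LocalizedModule.map (Submonoid.powers (degT k)) (rAct k R Q r) x)
            = LinearMap.rTensor (DegK k) (Algebra.lsmul k k M r) (f x))) :
    ∃ g : Q →ₗ[R ⊗[k] DegV k] (M ⊗[k] DegK k),
      TorsIso (Submonoid.powers ((1 : R) ⊗ₜ[k] degT k)) g := by
  letI := vRestrict k R Q
  obtain ⟨f, hf1, hf2⟩ := hf
  have hv : ∀ (v : DegV k) (q : Q), v • q = ((1 : R) ⊗ₜ[k] v : R ⊗[k] DegV k) • q := fun v q => rfl
  have hv1 : ∀ (v : DegV k) (q : Q), f (LocalizedModule.mk (v • q) 1) =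
     LinearMap.lTensor M (LinearMap.mulLeft k (algebraMap (DegV k) (DegK k) v)) (f (LocalizedModule.mk q 1)) := by
    intro v q
    rw [← hf1]
    congr 1
    refine ((LocalizedModule.smul'_mk v q (1 : Submonoid.powers (degT k))).symm).trans ?_
    exact (algebraMap_smul (Localization (Submonoid.powers (degT k))) v
      (LocalizedModule.mk q (1 : Submonoid.powers (degT k)))).symm
  have hr1 : ∀ (r : R) (q : Q), f (LocalizedModule.mk ((r ⊗ₜ[k] (1 : DegV k) : R ⊗[k] DegV k) • q) 1) =
     LinearMap.rTensor (DegK k) (Algebra.lsmul k k M r) (f (LocalizedModule.mk q 1)) := by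
    intro r q
    rw [← hf2, LocalizedModule.map_mk]
    rfl
  have hadd : ∀ q q' : Q, f (LocalizedModule.mk (q + q') 1) = f (LocalizedModule.mk q 1) + f (LocalizedModule.mk q' 1) := by
    intro q q'
    rw [← map_add]
    congr 1
    exact map_add (LocalizedModule.mkLinearMap (Submonoid.powers (degT k)) Q) q q'
  have hzero : f (LocalizedModule.mk (0 : Q) 1) = 0 := by
    rw [LocalizedModule.zero_mk, map_zero]
  let g : Q →ₗ[R ⊗[k] DegV k] (M ⊗[k] DegK k) :=
    { toFun := fun q => f (LocalizedModule.mk q 1)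
      map_add' := hadd
      map_smul' := by
        intro a q
        simp only [RingHom.id_apply]
        induction a with
        | zero => rw [zero_smul, zero_smul, hzero]
        | add x y hx hy => rw [add_smul, add_smul, hadd, hx, hy]
        | tmul r v =>
          have : (r ⊗ₜ[k] v : R ⊗[k] DegV k) • q = (r ⊗ₜ[k] (1 : DegV k) : R ⊗[k] DegV k) • (v • q) := by
            rw [hv, ← mul_smul, Algebra.TensorProduct.tmul_mul_tmul, mul_one, one_mul]
          rw [this, hr1, hv1, degL_smul] }
  have hpow : ∀ n : ℕ, ((1 : R) ⊗ₜ[k] degT k) ^ n = (1 : R) ⊗ₜ[k] (degT k ^ n) := by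
    intro n; rw [Algebra.TensorProduct.tmul_pow, one_pow]
  refine ⟨g, ?_, ?_⟩
  · intro q hq
    have h0 : LocalizedModule.mk q (1 : Submonoid.powers (degT k)) = 0 :=
      f.injective (Eq.trans hq (map_zero f).symm)
    rw [← LocalizedModule.zero_mk 1, LocalizedModule.mk_eq] at h0
    obtain ⟨⟨_, n, rfl⟩, hu⟩ := h0
    refine ⟨_, ⟨n, rfl⟩, ?_⟩
    simp only [one_smul, smul_zero, Submonoid.smul_def] at hu
    simp only [hpow]
    exact hu
  · intro l
    obtain ⟨x, rfl⟩ := f.surjective l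
    induction x using LocalizedModule.induction_on with
    | h q s =>
      obtain ⟨_, n, rfl⟩ := s
      refine ⟨_, ⟨n, rfl⟩, q, ?_⟩
      show (((1 : R) ⊗ₜ[k] degT k) ^ n : R ⊗[k] DegV k) • _ = f (LocalizedModule.mk q 1)
      rw [hpow, degL_smul, ← hf1, map_one]
      have e1 : ∀ y : M ⊗[k] DegK k, LinearMap.rTensor (DegK k) (1 : M →ₗ[k] M) y = y := by
        intro y; exact LinearMap.congr_fun (LinearMap.rTensor_id _ _) y
      refine (e1 _).trans ?_
      congr 1
      refine (algebraMap_smul (Localization (Submonoid.powers (degT k))) (degT k ^ n) (LocalizedModule.mk q (⟨_, n, rfl⟩ : Submonoid.powers (degT k)))).trans ?_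
      rw [LocalizedModule.smul'_mk]
      exact LocalizedModule.mk_cancel (⟨_, n, rfl⟩ : Submonoid.powers (degT k)) q

end latt

lemma isRegular_of_degenerates (k : Type) [Field k] (R : Type) [CommRing R]
    [IsNoetherianRing R] [IsLocalRing R] [Algebra k R]
    (e : R →ₐ[k] k) (he : ∀ r ∈ IsLocalRing.maximalIdeal R, e r = 0)
    (M N : Type) [AddCommGroup M] [Module R M] [Module.Finite R M]
    [AddCommGroup N] [Module R N]
    (hdeg : Degenerates k R M N) (rs : List R) (hrs : ∀ r ∈ rs, r ∈ IsLocalRing.maximalIdeal R)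
    (hreg : IsRegular N rs) : IsRegular M rs := by
  obtain ⟨Q, _, _, hfin, hflat, ⟨E⟩, hf⟩ := hdeg
  letI : Module k M := Module.compHom M (algebraMap k R)
  haveI : IsScalarTower k R M := IsScalarTower.of_algebraMap_smul fun _ _ => rfl
  letI := degLModule k R M
  obtain ⟨g, hg⟩ := exists_degG k R M Q hf
  have htau : IsSMulRegular Q ((1 : R) ⊗ₜ[k] degT k : R ⊗[k] DegV k) := by
    letI := vRestrict k R Q
    exact Module.Flat.isSMulRegular_of_nonZeroDivisors (R := DegV k) (M := Q)
      (mem_nonZeroDivisors_of_ne_zero (degT_ne_zero k))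
  have hnt : Nontrivial M := by
    by_contra hM
    rw [not_nontrivial_iff_subsingleton] at hM
    have hN := hreg.nontrivial
    have hQ : ∀ q : Q, q = 0 := by
      intro q
      have : g q = 0 := Subsingleton.elim _ _
      obtain ⟨_, ⟨n, rfl⟩, hs⟩ := hg.1 q this
      exact (htau.pow n) (hs.trans (smul_zero _).symm)
    obtain ⟨n, hn⟩ := exists_ne (0 : N)
    obtain ⟨x, rfl⟩ := E.surjective n
    obtain ⟨q, rfl⟩ := Submodule.Quotient.mk_surjective _ x
    exact hn (by rw [hQ q, Submodule.Quotient.mk_zero, map_zero])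
  refine RingTheory.Sequence.IsRegular.of_isWeaklyRegular_of_mem_maximalIdeal _ hrs ?_
  have hB := degB_ff k R e he
  refine main_abstract (B := Localization (degS k R e)) (degP k R e) ((1 : R) ⊗ₜ[k] degT k) ?_
    M Q _ g (degH k R M) hg (degH_torsIso k R M) rs ?_ ?_
  · show degPhi k R e _ ∈ IsLocalRing.maximalIdeal _
    rw [degPhi_tmul, map_one, map_one, one_mul]
    exact degT_mem k
  · intro r hr
    show degPhi k R e (r ⊗ₜ 1) ∈ IsLocalRing.maximalIdeal _
    rw [degPhi_tmul, he r (hrs r hr), map_zero, zero_mul]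
    exact zero_mem _
  · rw [isWeaklyRegular_cons_iff]
    refine ⟨htau, ?_⟩
    open Pointwise in
    have hsub : LinearMap.range (tSmul k R Q) = ((1 : R) ⊗ₜ[k] degT k : R ⊗[k] DegV k) • (⊤ : Submodule (R ⊗[k] DegV k) Q) := by
      ext q
      simp only [LinearMap.mem_range, Submodule.mem_smul_pointwise_iff_exists]
      exact ⟨fun ⟨y, hy⟩ => ⟨y, trivial, hy⟩, fun ⟨y, _, hy⟩ => ⟨y, hy⟩⟩
    let E2 := Submodule.quotEquivOfEq _ _ hsub
    have h1 : IsWeaklyRegular (Q ⧸ LinearMap.range (tSmul k R Q)) (rs.map (algebraMap R (R ⊗[k] DegV k))) := by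
      letI := rRestrict k R (Q ⧸ LinearMap.range (tSmul k R Q))
      refine (E.symm.toAddEquiv.isWeaklyRegular_congr ?_).mp hreg.toIsWeaklyRegular
      refine List.forall₂_map_right_iff.mpr (List.forall₂_same.mpr fun r _ x => ?_)
      exact E.symm.map_smul r x
    exact (E2.isWeaklyRegular_congr _).mp h1

lemma moduleDepth_le (R : Type) [CommRing R] [IsNoetherianRing R] [IsLocalRing R]
    (M : Type) [AddCommGroup M] [Module R M] [Module.Finite R M] :
    (moduleDepth R M : WithBot ℕ∞) ≤ ringKrullDim R := by
  have hb : ∀ rs : List R, IsRegular M rs → ((rs.length : ℕ∞) : WithBot ℕ∞) ≤ ringKrullDim R := by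
    intro rs h
    have h1 := Module.supportDim_add_length_eq_supportDim_of_isRegular rs h
    have h2 := Module.supportDim_le_ringKrullDim R M
    have := h.quot_ofList_smul_nontrivial ⊤
    have h3 : (0 : WithBot ℕ∞) ≤ Module.supportDim R (M ⧸ Ideal.ofList rs • (⊤ : Submodule R M)) := by
      have := Module.supportDim_ne_bot_of_nontrivial R (M ⧸ Ideal.ofList rs • (⊤ : Submodule R M))
      obtain ⟨d, hd⟩ := WithBot.ne_bot_iff_exists.mp this
      rw [← hd]
      exact_mod_cast zero_le
    calc ((rs.length : ℕ∞) : WithBot ℕ∞) = 0 + (rs.length : WithBot ℕ∞) := by simp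
      _ ≤ _ := add_le_add_left h3 _
      _ ≤ _ := h1.le.trans h2
  obtain ⟨d, hd⟩ := WithBot.ne_bot_iff_exists.mp (ringKrullDim_ne_bot (R := R))
  rw [← hd] at hb ⊢
  rw [WithBot.coe_le_coe]
  refine sSup_le ?_
  rintro n ⟨rs, rfl, -, hreg⟩
  exact WithBot.coe_le_coe.mp (hb rs hreg)

/-- over a complete Noetherian local Cohen–Macaulay `k`-algebra with
residue field `k`, if `M ⇒_deg N` and `N` is maximal Cohen–Macaulay then so is `M`. -/
theorem isMCM_of_degenerates (k : Type) [Field k] (R : Type) [CommRing R]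
    [IsNoetherianRing R] [IsLocalRing R] [Algebra k R]
    [IsAdicComplete (IsLocalRing.maximalIdeal R) R]
    (hres : Function.Bijective ⇑((IsLocalRing.residue R).comp (algebraMap k R)))
    (hCM : IsCMLocalRing R)
    (M N : Type) [AddCommGroup M] [Module R M] [Module.Finite R M]
    [AddCommGroup N] [Module R N] [Module.Finite R N]
    (hdeg : Degenerates k R M N) (hN : IsMCM R N) :
    IsMCM R M := by
  obtain ⟨e, he⟩ := exists_aug k R hres
  have hle : moduleDepth R N ≤ moduleDepth R M := by
    refine sSup_le ?_
    rintro n ⟨rs, rfl, hrs, hreg⟩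
    exact le_sSup ⟨rs, rfl, hrs, isRegular_of_degenerates k R e he M N hdeg rs hrs hreg⟩
  have h2 := moduleDepth_le R M
  refine le_antisymm h2 ?_
  rw [← show (moduleDepth R N : WithBot ℕ∞) = ringKrullDim R from hN]
  exact_mod_cast hle
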